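/- arXiv:2507.08947 — 2 statements merged into one kernel-verified Lean document; each statement's English description precedes it below -/
import Mathlib

section
/- Let G be an N×K complex matrix and C an N×N Hermitian positive definite complex matrix. Then G Gᴴ + C is invertible, the K×K matrix Gᴴ (G Gᴴ + C)⁻¹ G is Hermitian positive semidefinite, and I_K − Gᴴ (G Gᴴ + C)⁻¹ G is Hermitian positive definite. -/
open Matrix
open scoped ComplexOrder

/-- For `G` an `N × K` complex matrix and `C` an `N × N` Hermitian positive
definite matrix: `G Gᴴ + C` is invertible, `Gᴴ (G Gᴴ + C)⁻¹ G` is Hermitian positive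
semidefinite, and `I_K − Gᴴ (G Gᴴ + C)⁻¹ G` is Hermitian positive definite. -/
theorem gram_regularized_inverse_posdef
    {N K : ℕ} (G : Matrix (Fin N) (Fin K) ℂ) (C : Matrix (Fin N) (Fin N) ℂ)
    (hC : C.PosDef) :
    IsUnit (G * Gᴴ + C) ∧
      (Gᴴ * (G * Gᴴ + C)⁻¹ * G).PosSemidef ∧
      (1 - Gᴴ * (G * Gᴴ + C)⁻¹ * G).PosDef := by
  have hM : (G * Gᴴ + C).PosDef :=
    Matrix.PosDef.posSemidef_add (posSemidef_self_mul_conjTranspose G) hC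
  refine ⟨hM.isUnit, hM.inv.posSemidef.conjTranspose_mul_mul_same G, ?_⟩
  have hCC : C⁻¹⁻¹ = C :=
    Matrix.nonsing_inv_nonsing_inv C ((Matrix.isUnit_iff_isUnit_det C).1 hC.isUnit)
  have hP : (1 + Gᴴ * C⁻¹ * G).PosDef :=
    Matrix.PosDef.one.add_posSemidef (hC.inv.posSemidef.conjTranspose_mul_mul_same G)
  have hE : C⁻¹⁻¹ + G * (1 : Matrix (Fin K) (Fin K) ℂ)⁻¹ * Gᴴ = G * Gᴴ + C := by
    rw [hCC, inv_one, Matrix.mul_one, add_comm]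
  have h := Matrix.add_mul_mul_inv_eq_sub (1 : Matrix (Fin K) (Fin K) ℂ) Gᴴ C⁻¹ G
    isUnit_one hC.inv.isUnit (by rw [hE]; exact hM.isUnit)
  rw [hE, inv_one, Matrix.one_mul, Matrix.mul_one] at h
  rw [← h]
  exact hP.inv
end

section
/- Let L, K ≥ 1 and let Π_1, …, Π_L be K×K Hermitian complex matrices such that each Π_l is positive semidefinite and each I_K − Π_l is positive definite. Then for every tuple of vectors b_1, …, b_L ∈ ℂ^K, the linear system c_l + Σ_{j ≠ l} Π_j c_j = b_l (for all l ∈ {1, …, L}) has a unique solution (c_1, …, c_L) ∈ (ℂ^K)^L. -/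
open Matrix Finset
open scoped ComplexOrder

theorem aux_psd {K : ℕ} (P : Matrix (Fin K) (Fin K) ℂ) (h1 : P.PosSemidef)
    (h2 : (1 - P).PosDef) (d : Fin K → ℂ) :
    0 ≤ star (P *ᵥ d) ⬝ᵥ ((1 - P) *ᵥ d) := by
  have e : (P * (1 - P)).PosSemidef := by
    have a := h2.posSemidef.conjTranspose_mul_mul_same P
    have b := h1.conjTranspose_mul_mul_same (1 - P)
    rw [h1.isHermitian.eq] at a
    rw [h2.isHermitian.eq] at b
    have := a.add b
    convert this using 1
    noncomm_ring
  have := e.dotProduct_mulVec_nonneg d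
  rwa [← Matrix.mulVec_mulVec, Matrix.dotProduct_mulVec, ← h1.isHermitian.eq,
    ← Matrix.star_mulVec, h1.isHermitian.eq] at this

theorem aux_inj {L K : ℕ} (Pmat : Fin L → Matrix (Fin K) (Fin K) ℂ)
    (hpsd : ∀ l, (Pmat l).PosSemidef) (hpd : ∀ l, (1 - Pmat l).PosDef)
    (c : Fin L → Fin K → ℂ)
    (h : ∀ l, c l + ∑ j ∈ Finset.univ.erase l, Pmat j *ᵥ c j = 0) : c = 0 := by
  obtain ⟨s, hs⟩ : ∃ s, s = ∑ j, Pmat j *ᵥ c j := ⟨_, rfl⟩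
  have h' : ∀ l, (1 - Pmat l) *ᵥ c l = - s := by
    intro l
    have h0 := h l
    have h3 := Finset.add_sum_erase Finset.univ (fun j => Pmat j *ᵥ c j) (Finset.mem_univ l)
    rw [← hs] at h3
    rw [Matrix.sub_mulVec, Matrix.one_mulVec, ← h3, eq_neg_of_add_eq_zero_left h0]
    abel
  have h4 : 0 ≤ ∑ l, star (Pmat l *ᵥ c l) ⬝ᵥ ((1 - Pmat l) *ᵥ c l) :=
    Finset.sum_nonneg fun l _ => aux_psd _ (hpsd l) (hpd l) _
  simp only [h'] at h4
  rw [← sum_dotProduct, ← star_sum, ← hs, dotProduct_neg] at h4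
  have h5 : star s ⬝ᵥ s = 0 :=
    le_antisymm (neg_nonneg.mp h4) (dotProduct_star_self_nonneg s)
  have h6 : s = 0 := dotProduct_star_self_eq_zero.mp h5
  funext l
  by_contra hne
  have := (hpd l).dotProduct_mulVec_pos hne
  rw [h', h6] at this
  simp at this

/-- Let `Π_1, …, Π_L` be `K × K` Hermitian matrices with each `Π_l`
positive semidefinite and each `I_K − Π_l` positive definite. Then for every tuple of
vectors `b_1, …, b_L ∈ ℂ^K`, the linear system
`c_l + ∑_{j ≠ l} Π_j c_j = b_l` (for all `l`) has a unique solution. -/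
theorem team_mmse_linear_system_unique_solution
    {L K : ℕ} (hL : 1 ≤ L) (hK : 1 ≤ K)
    (Pmat : Fin L → Matrix (Fin K) (Fin K) ℂ)
    (hpsd : ∀ l, (Pmat l).PosSemidef) (hpd : ∀ l, (1 - Pmat l).PosDef)
    (b : Fin L → Fin K → ℂ) :
    ∃! c : Fin L → Fin K → ℂ,
      ∀ l, c l + ∑ j ∈ Finset.univ.erase l, Pmat j *ᵥ c j = b l := by
  let T : (Fin L → Fin K → ℂ) →ₗ[ℂ] (Fin L → Fin K → ℂ) :=
    { toFun := fun c l => c l + ∑ j ∈ Finset.univ.erase l, Pmat j *ᵥ c j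
      map_add' := by
        intro x y
        funext l
        simp only [Pi.add_apply, Matrix.mulVec_add, Finset.sum_add_distrib]
        abel
      map_smul' := by
        intro r x
        funext l
        simp only [Pi.smul_apply, Matrix.mulVec_smul, RingHom.id_apply, smul_add,
          Finset.smul_sum] }
  have hinj : Function.Injective T := by
    rw [injective_iff_map_eq_zero]
    intro c hc
    exact aux_inj Pmat hpsd hpd c fun l => congrFun hc l
  obtain ⟨c, hc⟩ := LinearMap.injective_iff_surjective.mp hinj b
  exact ⟨c, fun l => congrFun hc l, fun y hy => hinj ((funext hy : T y = b).trans hc.symm)⟩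
end
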